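/- arXiv:2411.04306 — 3 statements merged into one kernel-verified Lean document; each statement's English description precedes it below -/
import Mathlib

section
/- With the inner code and duality-preserving maps as in the context, let D ⊆ (F_q^k)^n be any F_q-linear subspace, and define the concatenated space E = φ̃_X(D) + Π C_Z^⊥ ⊆ (Σ^d)^n. Then the orthogonal complement of E inside F_q^{bdn} with respect to the standard bilinear form equals φ̃_Z(D^⊥) + Π C_X^⊥, where D^⊥ is the orthogonal complement of D inside F_q^{kn} with respect to the standard bilinear form. (Symmetrically, (φ̃_Z(D) + Π C_X^⊥)^⊥ = φ̃_X(D^⊥) + Π C_Z^⊥.) -/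
open scoped BigOperators

/-- A module equipped with a choice of "standard" bilinear dot product. -/
class DotSpace (F : Type*) [Field F] (M : Type*) [AddCommGroup M] [Module F M] where
  dot : M →ₗ[F] M →ₗ[F] F

/-- On the field itself the standard bilinear form is multiplication. -/
noncomputable instance (F : Type*) [Field F] : DotSpace F F :=
  ⟨LinearMap.mul F F⟩

/-- On a (finite) product, the standard bilinear form is the coordinatewise sum
`⟨u,v⟩ = ∑ i ⟨u i, v i⟩`. -/
noncomputable instance (F : Type*) [Field F] (ι : Type*) [Fintype ι]
    (M : Type*) [AddCommGroup M] [Module F M] [DotSpace F M] : DotSpace F (ι → M) where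
  dot := LinearMap.mk₂ F (fun u v => ∑ i, DotSpace.dot (F := F) (u i) (v i))
    (fun a b c => by simp [Finset.sum_add_distrib])
    (fun t a b => by simp [Finset.mul_sum])
    (fun a b c => by simp [Finset.sum_add_distrib])
    (fun t a b => by simp [Finset.mul_sum])

/-- The standard dot product `⟨u,v⟩ = ∑ i u_i v_i`. -/
def dotp (F : Type*) [Field F] {M : Type*} [AddCommGroup M] [Module F M] [DotSpace F M]
    (u v : M) : F := DotSpace.dot (F := F) u v

/-- Orthogonal complement `V^⊥ = {w | ∀ v ∈ V, ⟨v,w⟩ = 0}` with respect to the standard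
bilinear form. -/
def orth {F : Type*} [Field F] {M : Type*} [AddCommGroup M] [Module F M] [DotSpace F M]
    (V : Submodule F M) : Submodule F M where
  carrier := {w | ∀ v ∈ V, dotp F v w = 0}
  zero_mem' := fun v _ => map_zero (DotSpace.dot (F := F) v)
  add_mem' := fun {a b} ha hb v hv => by
    have h1 := ha v hv; have h2 := hb v hv
    unfold dotp at *
    rw [map_add, h1, h2, add_zero]
  smul_mem' := fun c a ha v hv => by
    have h1 := ha v hv
    unfold dotp at *
    rw [map_smul, h1, smul_zero]

/-- Coordinatewise application of a linear map `φ` to vectors indexed by `ι`. -/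
def coordwise {F : Type*} [Field F] {ι : Type*} {M N : Type*} [AddCommGroup M] [Module F M]
    [AddCommGroup N] [Module F N] (φ : M →ₗ[F] N) : (ι → M) →ₗ[F] (ι → N) :=
  LinearMap.pi fun i => φ.comp (LinearMap.proj i)

section DotProduct

variable {F : Type*} [Field F]

lemma dotp_field (a b : F) : dotp F a b = a * b := rfl

lemma dotp_pi {ι M : Type*} [Fintype ι] [AddCommGroup M] [Module F M] [DotSpace F M]
    (u v : ι → M) : dotp F u v = ∑ i, dotp F (u i) (v i) := rfl

variable {M N : Type*} [AddCommGroup M] [Module F M] [DotSpace F M]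
  [AddCommGroup N] [Module F N] [DotSpace F N]

lemma dotp_add_left (u v w : M) : dotp F (u + v) w = dotp F u w + dotp F v w := by
  simp [dotp]

lemma dotp_add_right (u v w : M) : dotp F u (v + w) = dotp F u v + dotp F u w := by
  simp [dotp]

lemma dotp_zero_left (v : M) : dotp F 0 v = 0 := by
  simp [dotp]

lemma dotp_pi_comm {ι : Type*} [Fintype ι] (h : ∀ u v : M, dotp F u v = dotp F v u)
    (u v : ι → M) : dotp F u v = dotp F v u := by
  simp only [dotp_pi, h]

lemma dotp_pi_single {ι : Type*} [Fintype ι] [DecidableEq ι] (i : ι) (x : M) (v : ι → M) :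
    dotp F (Pi.single i x) v = dotp F x (v i) := by
  rw [dotp_pi, Finset.sum_eq_single i]
  · simp
  · intro j _ hj
    simp [hj, dotp_zero_left]
  · simp

lemma eq_zero_of_dotp_pi {ι : Type*} [Fintype ι]
    (h : ∀ v : M, (∀ u, dotp F u v = 0) → v = 0)
    (v : ι → M) (hv : ∀ u, dotp F u v = 0) : v = 0 := by
  classical
  funext i
  exact h _ fun x => by rw [← dotp_pi_single i x v, hv]

lemma orth_orth [FiniteDimensional F M] (hcomm : ∀ u v : M, dotp F u v = dotp F v u)
    (hnd : ∀ v : M, (∀ u, dotp F u v = 0) → v = 0) (V : Submodule F M) :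
    orth (orth V) = V := by
  have hrefl : LinearMap.BilinForm.IsRefl (DotSpace.dot (F := F) (M := M)) :=
    fun u v huv => (hcomm v u).trans huv
  exact LinearMap.BilinForm.orthogonal_orthogonal (B := DotSpace.dot (F := F) (M := M))
    ⟨fun u hu => hnd u fun v => (hcomm v u).trans (hu v), fun v hv => hnd v hv⟩ hrefl V

/-- The dual of a concatenated space, for a symmetric form and a self-bidual inner code. -/
lemma orth_map_coordwise_sup_pi {ι : Type*} [Fintype ι]
    (hcomm : ∀ u v : N, dotp F u v = dotp F v u)
    {CX CZ : Submodule F N} (hbidual : orth (orth CZ) = CZ)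
    {φX φZ : M →ₗ[F] N} (hdual : ∀ u v, dotp F (φX u) (φZ v) = dotp F u v)
    (hX : LinearMap.range φX ≤ CX) (hZ : LinearMap.range φZ ⊔ orth CX = CZ)
    (D : Submodule F (ι → M)) :
    orth (Submodule.map (coordwise φX) D ⊔ Submodule.pi Set.univ fun _ : ι => orth CZ)
      = Submodule.map (coordwise φZ) (orth D) ⊔ Submodule.pi Set.univ fun _ : ι => orth CX := by
  classical
  have hpair : ∀ (x a : ι → M) (c : ι → N), (∀ i, c i ∈ orth CX) →
      dotp F (coordwise φX x) (coordwise φZ a + c) = dotp F x a := by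
    intro x a c hc
    simp only [dotp_pi]
    refine Finset.sum_congr rfl fun i _ => ?_
    change dotp F (φX (x i)) (φZ (a i) + c i) = _
    rw [dotp_add_right, hdual, hc i _ (hX ⟨_, rfl⟩), add_zero]
  ext w
  constructor
  · intro hw
    have hwZ : ∀ i, w i ∈ LinearMap.range φZ ⊔ orth CX := by
      intro i
      rw [hZ, ← hbidual]
      intro p hp
      rw [← dotp_pi_single i p w]
      refine hw _ (Submodule.mem_sup_right fun j _ => ?_)
      obtain rfl | hj := eq_or_ne j i
      · simpa using hp
      · simp [hj]
    simp only [Submodule.mem_sup, LinearMap.mem_range] at hwZ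
    choose y hy c hc hyc using hwZ
    choose a ha using hy
    have hw_eq : coordwise φZ a + c = w := by
      funext i
      rw [← hyc i, ← ha i]
      rfl
    rw [← hw_eq] at hw ⊢
    refine Submodule.add_mem_sup (Submodule.mem_map_of_mem fun x hx => ?_) fun i _ => hc i
    rw [← hpair x a c hc]
    exact hw _ (Submodule.mem_sup_left (Submodule.mem_map_of_mem hx))
  · intro hw
    obtain ⟨_, ⟨a, ha, rfl⟩, c, hc, rfl⟩ := Submodule.mem_sup.mp hw
    intro v hv
    obtain ⟨_, ⟨x, hx, rfl⟩, p, hp, rfl⟩ := Submodule.mem_sup.mp hv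
    rw [dotp_add_left, hpair x a c fun i => hc i trivial, ha x hx, zero_add, dotp_pi]
    refine Finset.sum_eq_zero fun i _ => ?_
    rw [hcomm]
    refine hp i trivial _ ?_
    rw [← hZ]
    exact Submodule.add_mem_sup ⟨a i, rfl⟩ (hc i trivial)

end DotProduct

/-- For an inner CSS code `(C_X, C_Z)` in `Σ^d = (F_q^b)^d` with
duality-preserving maps `φ_X, φ_Z : F_q^k → Σ^d`, and any outer subspace
`D ⊆ (F_q^k)^n`, the dual of the concatenated space `E = φ̃_X(D) + Π C_Z^⊥` is
`φ̃_Z(D^⊥) + Π C_X^⊥` (and symmetrically). -/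
theorem stmt2 (F : Type*) [Field F] [Fintype F]
    (n d b k : ℕ) (hn : 0 < n) (hd : 0 < d) (hb : 0 < b) (hk : 0 < k)
    (CX CZ : Submodule F (Fin d → Fin b → F))
    (hCZX : orth CZ ≤ CX) (hCXZ : orth CX ≤ CZ)
    (φX φZ : (Fin k → F) →ₗ[F] (Fin d → Fin b → F))
    (hXinj : Function.Injective φX) (hZinj : Function.Injective φZ)
    (hdual : ∀ u v : Fin k → F, dotp F (φX u) (φZ v) = dotp F u v)
    (hCXsup : LinearMap.range φX ⊔ orth CZ = CX)
    (hCXinf : LinearMap.range φX ⊓ orth CZ = ⊥)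
    (hCZsup : LinearMap.range φZ ⊔ orth CX = CZ)
    (hCZinf : LinearMap.range φZ ⊓ orth CX = ⊥)
    (D : Submodule F (Fin n → Fin k → F)) :
    orth (Submodule.map (coordwise (ι := Fin n) φX) D
          ⊔ Submodule.pi Set.univ (fun _ : Fin n => orth CZ))
      = Submodule.map (coordwise (ι := Fin n) φZ) (orth D)
          ⊔ Submodule.pi Set.univ (fun _ : Fin n => orth CX)
    ∧ orth (Submodule.map (coordwise (ι := Fin n) φZ) D
          ⊔ Submodule.pi Set.univ (fun _ : Fin n => orth CX))
      = Submodule.map (coordwise (ι := Fin n) φX) (orth D)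
          ⊔ Submodule.pi Set.univ (fun _ : Fin n => orth CZ) := by
  have hcomm : ∀ u v : Fin d → Fin b → F, dotp F u v = dotp F v u :=
    dotp_pi_comm (dotp_pi_comm fun u v => mul_comm u v)
  have hcomm' : ∀ u v : Fin k → F, dotp F u v = dotp F v u :=
    dotp_pi_comm fun u v => mul_comm u v
  have hnd : ∀ v : Fin d → Fin b → F, (∀ u, dotp F u v = 0) → v = 0 :=
    eq_zero_of_dotp_pi (eq_zero_of_dotp_pi fun v hv => by simpa [dotp_field] using hv 1)
  exact ⟨orth_map_coordwise_sup_pi hcomm (orth_orth hcomm hnd CZ) hdual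
      (le_sup_left.trans hCXsup.le) hCZsup D,
    orth_map_coordwise_sup_pi hcomm (orth_orth hcomm hnd CX)
      (fun u v => by rw [hcomm, hdual, hcomm']) (le_sup_left.trans hCZsup.le) hCXsup D⟩
end

section
/- With the inner code and duality-preserving maps as in the context, let D_X, D_Z ⊆ (F_q^k)^n be F_q-linear subspaces with D_Z^⊥ ⊆ D_X, and set E_X = φ̃_X(D_X) + Π C_Z^⊥ and E'_Z = φ̃_X(D_Z^⊥) + Π C_Z^⊥ (so E'_Z is the orthogonal complement of the concatenated Z-code). Then both sums are direct, and dim_{F_q}(E_X) − dim_{F_q}(E'_Z) = dim_{F_q}(D_X) − dim_{F_q}(D_Z^⊥). In particular the concatenated CSS code has F_q-dimension equal to that of the outer code. -/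
open scoped BigOperators

theorem coordwise_injective {F ι M N : Type*} [Field F] [AddCommGroup M] [Module F M]
    [AddCommGroup N] [Module F N] {φ : M →ₗ[F] N} (hφ : Function.Injective φ) :
    Function.Injective (coordwise (ι := ι) φ) :=
  fun _ _ h => funext fun i => hφ (congrFun h i)

theorem map_coordwise_inf_pi_eq_bot {F ι M N : Type*} [Field F] [AddCommGroup M] [Module F M]
    [AddCommGroup N] [Module F N] {φ : M →ₗ[F] N} {W : Submodule F N}
    (h : LinearMap.range φ ⊓ W = ⊥) (D : Submodule F (ι → M)) :
    Submodule.map (coordwise φ) D ⊓ Submodule.pi Set.univ (fun _ : ι => W) = ⊥ := by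
  rw [eq_bot_iff]
  rintro _ ⟨⟨u, -, rfl⟩, hW⟩
  refine (Submodule.mem_bot F).2 (funext fun i => (Submodule.mem_bot F).1 ?_)
  rw [← h]
  exact ⟨⟨u i, rfl⟩, hW i trivial⟩

theorem finrank_map_sup_of_inf_eq_bot {F V W : Type*} [Field F] [AddCommGroup V] [Module F V]
    [AddCommGroup W] [Module F W] [FiniteDimensional F W] {f : V →ₗ[F] W}
    (hf : Function.Injective f) {D : Submodule F V} {P : Submodule F W}
    (h : Submodule.map f D ⊓ P = ⊥) :
    Module.finrank F ↥(Submodule.map f D ⊔ P) = Module.finrank F D + Module.finrank F P := by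
  have key := Submodule.finrank_sup_add_finrank_inf_eq (Submodule.map f D) P
  rwa [h, finrank_bot, add_zero, LinearEquiv.finrank_eq (D.equivMapOfInjective f hf).symm] at key

/-- With the inner code and duality-preserving maps as in the context,
and an outer CSS pair `D_Z^⊥ ⊆ D_X` in `(F_q^k)^n`, the sums
`E_X = φ̃_X(D_X) + Π C_Z^⊥` and `E'_Z = φ̃_X(D_Z^⊥) + Π C_Z^⊥` are direct, and
`dim E_X − dim E'_Z = dim D_X − dim D_Z^⊥`. -/
theorem stmt3 (F : Type*) [Field F] [Fintype F]
    (n d b k : ℕ) (hn : 0 < n) (hd : 0 < d) (hb : 0 < b) (hk : 0 < k)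
    (CX CZ : Submodule F (Fin d → Fin b → F))
    (hCZX : orth CZ ≤ CX) (hCXZ : orth CX ≤ CZ)
    (φX φZ : (Fin k → F) →ₗ[F] (Fin d → Fin b → F))
    (hXinj : Function.Injective φX) (hZinj : Function.Injective φZ)
    (hdual : ∀ u v : Fin k → F, dotp F (φX u) (φZ v) = dotp F u v)
    (hCXsup : LinearMap.range φX ⊔ orth CZ = CX)
    (hCXinf : LinearMap.range φX ⊓ orth CZ = ⊥)
    (hCZsup : LinearMap.range φZ ⊔ orth CX = CZ)
    (hCZinf : LinearMap.range φZ ⊓ orth CX = ⊥)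
    (DX DZ : Submodule F (Fin n → Fin k → F))
    (hDZX : orth DZ ≤ DX) :
    Submodule.map (coordwise (ι := Fin n) φX) DX
        ⊓ Submodule.pi Set.univ (fun _ : Fin n => orth CZ) = ⊥
    ∧ Submodule.map (coordwise (ι := Fin n) φX) (orth DZ)
        ⊓ Submodule.pi Set.univ (fun _ : Fin n => orth CZ) = ⊥
    ∧ (Module.finrank F ↥(Submodule.map (coordwise (ι := Fin n) φX) DX
          ⊔ Submodule.pi Set.univ (fun _ : Fin n => orth CZ)) : ℤ)
        - (Module.finrank F ↥(Submodule.map (coordwise (ι := Fin n) φX) (orth DZ)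
          ⊔ Submodule.pi Set.univ (fun _ : Fin n => orth CZ)) : ℤ)
      = (Module.finrank F ↥DX : ℤ) - (Module.finrank F ↥(orth DZ) : ℤ) := by
  have hX := map_coordwise_inf_pi_eq_bot (ι := Fin n) hCXinf DX
  have hZ := map_coordwise_inf_pi_eq_bot (ι := Fin n) hCXinf (orth DZ)
  refine ⟨hX, hZ, ?_⟩
  rw [finrank_map_sup_of_inf_eq_bot (coordwise_injective hXinj) hX,
    finrank_map_sup_of_inf_eq_bot (coordwise_injective hXinj) hZ]
  push_cast
  ring
end

section
/- With the inner code, duality-preserving maps, outer code, and graph as in the context, suppose: every c ∈ (C_X \ C_Z^⊥) ∪ (C_Z \ C_X^⊥) has at least δ_in·d nonzero Σ-coordinates; every u ∈ (D_X \ D_Z^⊥) ∪ (D_Z \ D_X^⊥) has at least δ_out·n nonzero F_q^k-coordinates; δ_out > 0; and G satisfies the λ-expander mixing property. Define the concatenated codes on the edges of G via left blocks: E_X = {z ∈ Σ^E : (z_ℓ)_{ℓ∈L} ∈ φ̃_X(D_X) + Π C_Z^⊥} and E_Z = {z ∈ Σ^E : (z_ℓ)_{ℓ∈L} ∈ φ̃_Z(D_Z)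 + Π C_X^⊥}, with E_Z^⊥ = {z : (z_ℓ)_ℓ ∈ φ̃_X(D_Z^⊥) + Π C_Z^⊥} and E_X^⊥ = {z : (z_ℓ)_ℓ ∈ φ̃_Z(D_X^⊥) + Π C_X^⊥}. Then for every z ∈ (E_X \ E_Z^⊥) ∪ (E_Z \ E_X^⊥), the number of right vertices r ∈ R with z_r ≠ 0 is at least (δ_in − λ/δ_out)·n; i.e., the AEL-amplified code has relative distance at least δ_in − λ/δ_out. -/
open scoped BigOperators

open scoped BigOperators

/-- A `d`-regular bipartite (multi)graph with left vertices `L`, right vertices `R` and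
edge set `E`: each edge `e` has a left endpoint `eL e` and a right endpoint `eR e`, and
each vertex comes with a fixed ordering of the `d` edges incident to it. -/
structure BipartiteGraph (L R E : Type*) (d : ℕ) where
  eL : E → L
  eR : E → R
  oL : (ℓ : L) → Fin d ≃ {e : E // eL e = ℓ}
  oR : (r : R) → Fin d ≃ {e : E // eR e = r}

namespace BipartiteGraph

variable {L R E : Type*} {d : ℕ}

/-- The block of `z : E → A` at a left vertex `ℓ`, an element of `A^d`. -/
def blockL {A : Type*} (G : BipartiteGraph L R E d) (z : E → A) (ℓ : L) : Fin d → A :=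
  fun i => z (G.oL ℓ i).1

/-- The block of `z : E → A` at a right vertex `r`, an element of `A^d`. -/
def blockR {A : Type*} (G : BipartiteGraph L R E d) (z : E → A) (r : R) : Fin d → A :=
  fun i => z (G.oR r i).1

/-- The `λ`-expander mixing property: for all `f : L → ℝ`, `g : R → ℝ`,
`|E_{(ℓ,r) ∈ E}[f(ℓ)g(r)] − E_ℓ[f]·E_r[g]| ≤ λ √(E_ℓ[f²]) √(E_r[g²])`. -/
def EML [Fintype L] [Fintype R] [Fintype E] (G : BipartiteGraph L R E d) (lam : ℝ) : Prop :=
  ∀ (f : L → ℝ) (g : R → ℝ),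
    |(∑ e, f (G.eL e) * g (G.eR e)) / (Fintype.card E : ℝ) -
        ((∑ ℓ, f ℓ) / (Fintype.card L : ℝ)) * ((∑ r, g r) / (Fintype.card R : ℝ))| ≤
      lam * Real.sqrt ((∑ ℓ, f ℓ ^ 2) / (Fintype.card L : ℝ)) *
        Real.sqrt ((∑ r, g r ^ 2) / (Fintype.card R : ℝ))

end BipartiteGraph

theorem sum_ite_one_eq_ncard {ι : Type*} [Fintype ι] (p : ι → Prop) [DecidablePred p] :
    ∑ i, (if p i then (1 : ℝ) else 0) = ({i | p i} : Set ι).ncard := by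
  rw [Finset.sum_boole, Set.ncard_eq_toFinset_card', Set.toFinset_ofPred]

namespace BipartiteGraph

variable {L R E : Type*} {d : ℕ}

theorem sum_edges_eq_sum_left [Fintype L] [Fintype E] (G : BipartiteGraph L R E d) (h : E → ℝ) :
    ∑ e, h e = ∑ ℓ, ∑ i, h (G.oL ℓ i).1 := by
  rw [← Fintype.sum_sigma']
  exact (Equiv.sum_comp ((Equiv.sigmaCongrRight G.oL).trans (Equiv.sigmaFiberEquiv G.eL)) h).symm

theorem card_edges [Fintype L] [Fintype E] (G : BipartiteGraph L R E d) :
    (Fintype.card E : ℝ) = Fintype.card L * d := by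
  simpa using G.sum_edges_eq_sum_left (fun _ => 1)

theorem eL_oL (G : BipartiteGraph L R E d) (ℓ : L) (i : Fin d) : G.eL (G.oL ℓ i).1 = ℓ :=
  (G.oL ℓ i).2

theorem blockR_ne_zero {A : Type*} [Zero A] (G : BipartiteGraph L R E d) {z : E → A} {e : E}
    (he : z e ≠ 0) : G.blockR z (G.eR e) ≠ 0 := by
  intro h
  apply he
  simpa [blockR] using congrFun h ((G.oR (G.eR e)).symm ⟨e, rfl⟩)

theorem EML.nonneg [Fintype L] [Fintype R] [Fintype E] [Nonempty L] [Nonempty R]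
    {G : BipartiteGraph L R E d} {lam : ℝ} (h : G.EML lam) : 0 ≤ lam := by
  have h1 := (abs_nonneg _).trans (h (fun _ => 1) (fun _ => 1))
  simpa using h1

open Classical in
/-- If every left block in `S` has at least `δ * d` nonzero entries and `S` has density at least
`ε`, then the density of nonzero right blocks is at least `δ - lam / ε`. -/
theorem EML.le_ncard_blockR [Fintype L] [Fintype R] [Fintype E] {A : Type*} [Zero A]
    {G : BipartiteGraph L R E d} {lam δ ε : ℝ} {n : ℕ} (hn : 0 < n) (hd : 0 < d)
    (hL : Fintype.card L = n) (hR : Fintype.card R = n) (hG : G.EML lam) (hε : 0 < ε)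
    (z : E → A) (S : Set L) (hS : ε * n ≤ (S.ncard : ℝ))
    (hz : ∀ ℓ ∈ S, δ * d ≤ (({i : Fin d | G.blockL z ℓ i ≠ 0} : Set (Fin d)).ncard : ℝ)) :
    (δ - lam / ε) * n ≤ (({r : R | G.blockR z r ≠ 0} : Set R).ncard : ℝ) := by
  have : Nonempty L := Fintype.card_pos_iff.1 (hL ▸ hn)
  have : Nonempty R := Fintype.card_pos_iff.1 (hR ▸ hn)
  have hlam := hG.nonneg
  have hn' : (0 : ℝ) < n := by exact_mod_cast hn
  have hd' : (0 : ℝ) < d := by exact_mod_cast hd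
  set T : Set R := {r | G.blockR z r ≠ 0}
  have hsumS : ∑ ℓ, (if ℓ ∈ S then (1 : ℝ) else 0) = S.ncard :=
    sum_ite_one_eq_ncard (· ∈ S)
  have hsumT : ∑ r, (if r ∈ T then (1 : ℝ) else 0) = T.ncard :=
    sum_ite_one_eq_ncard (· ∈ T)
  have hSn : (S.ncard : ℝ) ≤ n := by
    rw [← hL, ← Nat.card_eq_fintype_card]; exact_mod_cast Set.ncard_le_card S
  have hTn : (T.ncard : ℝ) ≤ n := by
    rw [← hR, ← Nat.card_eq_fintype_card]; exact_mod_cast Set.ncard_le_card T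
  have hmix := hG (fun ℓ => if ℓ ∈ S then 1 else 0) (fun r => if r ∈ T then 1 else 0)
  have hlow : δ * d * S.ncard ≤
      ∑ e, (if G.eL e ∈ S then (1 : ℝ) else 0) * (if G.eR e ∈ T then 1 else 0) := by
    rw [G.sum_edges_eq_sum_left, ← hsumS, Finset.mul_sum]
    refine Finset.sum_le_sum fun ℓ _ => ?_
    simp only [eL_oL]
    by_cases hℓ : ℓ ∈ S
    · simp only [hℓ, if_true, mul_one, one_mul]
      refine (hz ℓ hℓ).trans ?_
      rw [← sum_ite_one_eq_ncard]
      refine Finset.sum_le_sum fun i _ => ?_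
      by_cases hi : G.blockL z ℓ i ≠ 0
      · have hiT : G.eR (G.oL ℓ i).1 ∈ T := G.blockR_ne_zero hi
        rw [if_pos hi, if_pos hiT]
      · rw [if_neg hi]
        split_ifs <;> norm_num
    · simp [hℓ]
  simp only [ite_pow, one_pow, ne_eq, OfNat.ofNat_ne_zero, not_false_eq_true, zero_pow, hsumS,
    hsumT, hL, hR, G.card_edges] at hmix
  set s : ℝ := (S.ncard : ℝ) / n with hs
  set t : ℝ := (T.ncard : ℝ) / n
  have hs1 : s ≤ 1 := (div_le_one hn').2 hSn
  have ht1 : t ≤ 1 := (div_le_one hn').2 hTn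
  have hεs : ε ≤ s := (le_div_iff₀ hn').2 hS
  have hs0 : 0 < s := hε.trans_le hεs
  have hsqrt : lam * √s * √t ≤ lam := by
    rw [mul_assoc]
    exact mul_le_of_le_one_right hlam
      (mul_le_one₀ (Real.sqrt_le_one.2 hs1) (Real.sqrt_nonneg _) (Real.sqrt_le_one.2 ht1))
  have hdens : δ * s ≤
      (∑ e, (if G.eL e ∈ S then (1 : ℝ) else 0) * (if G.eR e ∈ T then 1 else 0)) / (n * d) := by
    rw [le_div_iff₀ (by positivity)]
    calc δ * s * (n * d) = δ * d * S.ncard := by rw [hs]; field_simp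
      _ ≤ _ := hlow
  have hmain : δ * s ≤ s * t + lam := by linarith [(le_abs_self _).trans hmix]
  have hδ : δ ≤ t + lam / s := by
    rw [← mul_le_mul_iff_left₀ hs0, add_mul, div_mul_cancel₀ _ hs0.ne']
    linarith
  have hle : lam / s ≤ lam / ε := div_le_div_of_nonneg_left hlam hε hεs
  rw [← le_div_iff₀ hn']
  linarith

end BipartiteGraph

theorem exists_outer_of_mem_concat {F : Type*} [Field F] {ι : Type*} {M N : Type*}
    [AddCommGroup M] [Module F M] [AddCommGroup N] [Module F N] {φ : M →ₗ[F] N}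
    (hinj : Function.Injective φ) {C W : Submodule F N}
    (hsup : LinearMap.range φ ⊔ W = C) (hinf : LinearMap.range φ ⊓ W = ⊥)
    {D D' : Submodule F (ι → M)} {y : ι → N}
    (hy : y ∈ Submodule.map (coordwise (ι := ι) φ) D ⊔ Submodule.pi Set.univ (fun _ : ι => W))
    (hy' : y ∉ Submodule.map (coordwise (ι := ι) φ) D' ⊔ Submodule.pi Set.univ (fun _ : ι => W)) :
    ∃ u ∈ D, u ∉ D' ∧ ∀ i, u i ≠ 0 → y i ∈ C ∧ y i ∉ W := by
  obtain ⟨_, ⟨u, hu, rfl⟩, w, hw, rfl⟩ := Submodule.mem_sup.1 hy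
  have hwi : ∀ i, w i ∈ W := fun i => hw i (Set.mem_univ i)
  refine ⟨u, hu, fun hu' => hy' ?_, fun i hi => ⟨?_, fun h => hi ?_⟩⟩
  · exact Submodule.add_mem_sup (Submodule.mem_map_of_mem hu') hw
  · rw [← hsup]
    exact Submodule.add_mem_sup (LinearMap.mem_range_self φ (u i)) (hwi i)
  · have h1 : φ (u i) ∈ W := (Submodule.add_mem_iff_left W (hwi i)).1 h
    have h2 : φ (u i) ∈ LinearMap.range φ ⊓ W := ⟨LinearMap.mem_range_self φ _, h1⟩
    rw [hinf, Submodule.mem_bot] at h2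
    exact hinj (h2.trans (map_zero φ).symm)

/-- (AEL distance amplification.) With inner code `(C_X, C_Z)` of
relative distance `δ_in`, duality-preserving maps `φ_X, φ_Z`, an outer CSS code
`(D_X, D_Z)` (indexed by the left vertices `L`) of relative distance `δ_out > 0`, and a
`d`-regular bipartite graph `G` satisfying `λ`-mixing, every
`z ∈ (E_X \ E_Z^⊥) ∪ (E_Z \ E_X^⊥)` of the concatenated code has at least
`(δ_in − λ/δ_out)·n` nonzero right blocks. -/
theorem stmt6 (F : Type*) [Field F] [Fintype F]
    (L R E : Type*) [Fintype L] [Fintype R] [Fintype E]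
    (n d b k : ℕ) (hn : 0 < n) (hd : 0 < d)
    (hL : Fintype.card L = n) (hR : Fintype.card R = n)
    (G : BipartiteGraph L R E d)
    (CX CZ : Submodule F (Fin d → Fin b → F))
    (hCZX : orth CZ ≤ CX) (hCXZ : orth CX ≤ CZ)
    (φX φZ : (Fin k → F) →ₗ[F] (Fin d → Fin b → F))
    (hXinj : Function.Injective φX) (hZinj : Function.Injective φZ)
    (hdual : ∀ u v : Fin k → F, dotp F (φX u) (φZ v) = dotp F u v)
    (hCXsup : LinearMap.range φX ⊔ orth CZ = CX)
    (hCXinf : LinearMap.range φX ⊓ orth CZ = ⊥)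
    (hCZsup : LinearMap.range φZ ⊔ orth CX = CZ)
    (hCZinf : LinearMap.range φZ ⊓ orth CX = ⊥)
    (δin δout lam : ℝ) (hδout : 0 < δout)
    (hinner : ∀ c : Fin d → Fin b → F,
      ((c ∈ CX ∧ c ∉ orth CZ) ∨ (c ∈ CZ ∧ c ∉ orth CX)) →
      δin * d ≤ (({i : Fin d | c i ≠ 0} : Set (Fin d)).ncard : ℝ))
    (DX DZ : Submodule F (L → Fin k → F))
    (hDZX : orth DZ ≤ DX) (hDXZ : orth DX ≤ DZ)
    (houter : ∀ u : L → Fin k → F,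
      ((u ∈ DX ∧ u ∉ orth DZ) ∨ (u ∈ DZ ∧ u ∉ orth DX)) →
      δout * n ≤ (({ℓ : L | u ℓ ≠ 0} : Set L).ncard : ℝ))
    (hEML : G.EML lam)
    (z : E → (Fin b → F))
    (hz : (G.blockL z ∈ Submodule.map (coordwise (ι := L) φX) DX
              ⊔ Submodule.pi Set.univ (fun _ : L => orth CZ)
            ∧ G.blockL z ∉ Submodule.map (coordwise (ι := L) φX) (orth DZ)
              ⊔ Submodule.pi Set.univ (fun _ : L => orth CZ))
        ∨ (G.blockL z ∈ Submodule.map (coordwise (ι := L) φZ) DZ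
              ⊔ Submodule.pi Set.univ (fun _ : L => orth CX)
            ∧ G.blockL z ∉ Submodule.map (coordwise (ι := L) φZ) (orth DX)
              ⊔ Submodule.pi Set.univ (fun _ : L => orth CX))) :
    (δin - lam / δout) * n ≤ (({r : R | G.blockR z r ≠ 0} : Set R).ncard : ℝ) := by
  rcases hz with ⟨h, h'⟩ | ⟨h, h'⟩
  · obtain ⟨u, hu, hu', hblock⟩ := exists_outer_of_mem_concat hXinj hCXsup hCXinf h h'
    exact hEML.le_ncard_blockR hn hd hL hR hδout z {ℓ | u ℓ ≠ 0} (houter u (.inl ⟨hu, hu'⟩))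
      fun ℓ hℓ => hinner _ (.inl (hblock ℓ hℓ))
  · obtain ⟨u, hu, hu', hblock⟩ := exists_outer_of_mem_concat hZinj hCZsup hCZinf h h'
    exact hEML.le_ncard_blockR hn hd hL hR hδout z {ℓ | u ℓ ≠ 0} (houter u (.inr ⟨hu, hu'⟩))
      fun ℓ hℓ => hinner _ (.inr (hblock ℓ hℓ))
end
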